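/- Let A be a nonempty subset of a metric space ⟨X,d⟩. The following conditions are equivalent: (i) A is a UC-subset of X; (ii) for every continuous function f : X → ℝ, the oscillation Ω(f,A) is finite; (iii) whenever C and E are nonempty closed subsets of X with C ⊆ A and C ∩ E = ∅, the gap between C and E is positive, i.e., inf{d(c,e) : c ∈ C, e ∈ E} > 0. -/

import Mathlib

open Metric Filter ENNReal Topology

/-- The `ε`-enlargement `S_d(A,ε) = ⋃_{a ∈ A} S_d(a,ε)` of a set `A`. -/
def SEnl {X : Type*} [MetricSpace X] (A : Set X) (ε : ℝ) : Set X :=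
  ⋃ a ∈ A, Metric.ball a ε

/-- `Ω_n(f,A) = sup {ρ(f x, f w) : x, w ∈ S_d(A,1/n), d(x,w) < 1/n}` in `[0,∞]`. -/
noncomputable def OmegaN {X Y : Type*} [MetricSpace X] [MetricSpace Y]
    (f : X → Y) (A : Set X) (n : ℕ) : ℝ≥0∞ :=
  ⨆ (x ∈ SEnl A (1 / (n : ℝ))) (w ∈ SEnl A (1 / (n : ℝ))) (_ : dist x w < 1 / (n : ℝ)),
    edist (f x) (f w)

/-- The oscillation `Ω(f,A) = inf_{n ≥ 1} Ω_n(f,A)` of `f` at `A`. -/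
noncomputable def Omega {X Y : Type*} [MetricSpace X] [MetricSpace Y]
    (f : X → Y) (A : Set X) : ℝ≥0∞ :=
  ⨅ n : ℕ, OmegaN f A (n + 1)

/-- `A` is a UC-subset: every sequence `⟨a_n⟩` in `A` with
`d(a_n, X ∖ {a_n}) → 0` has a cluster point in `X`. -/
def IsUCSubset {X : Type*} [MetricSpace X] (A : Set X) : Prop :=
  ∀ a : ℕ → X, (∀ n, a n ∈ A) →
    Tendsto (fun n => Metric.infDist (a n) ({a n}ᶜ)) atTop (𝓝 0) →
    ∃ x : X, MapClusterPt x atTop a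

/-- The gap `inf {d(c,e) : c ∈ C, e ∈ E}` between two sets. -/
noncomputable def gap {X : Type*} [MetricSpace X] (C E : Set X) : ℝ :=
  sInf {r : ℝ | ∃ c ∈ C, ∃ e ∈ E, r = dist c e}

theorem mem_SEnl_iff {X : Type*} [MetricSpace X] {A : Set X} {ε : ℝ} {x : X} :
    x ∈ SEnl A ε ↔ ∃ a ∈ A, dist x a < ε := by
  simp [SEnl]

theorem mapClusterPt_iff_forall_dist_lt {X : Type*} [MetricSpace X] {u : ℕ → X} {x : X} :
    MapClusterPt x atTop u ↔ ∀ ε > 0, ∃ᶠ n in atTop, dist (u n) x < ε :=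
  Metric.nhds_basis_ball.mapClusterPt_iff_frequently

theorem MapClusterPt.of_tendsto_dist {X : Type*} [MetricSpace X] {u v : ℕ → X} {x : X}
    (hv : MapClusterPt x atTop v) (h : Tendsto (fun n => dist (u n) (v n)) atTop (𝓝 0)) :
    MapClusterPt x atTop u := by
  rw [mapClusterPt_iff_forall_dist_lt] at hv ⊢
  intro ε hε
  refine ((hv (ε / 2) (half_pos hε)).and_eventually
    (h.eventually_lt_const (half_pos hε))).mono fun n hn => ?_
  linarith [dist_triangle (u n) (v n) x, hn.1, hn.2]

theorem locallyFinite_singleton_of_not_mapClusterPt {X : Type*} [MetricSpace X] {u : ℕ → X}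
    (h : ∀ x, ¬ MapClusterPt x atTop u) : LocallyFinite fun n => ({u n} : Set X) := by
  intro x
  have hx := h x
  rw [mapClusterPt_iff_frequently] at hx
  push Not at hx
  obtain ⟨s, hs, hfin⟩ := hx
  refine ⟨s, hs, ?_⟩
  rw [← Nat.cofinite_eq_atTop, eventually_cofinite] at hfin
  refine hfin.subset fun n hn => ?_
  simpa using hn

theorem isClosed_range_of_not_mapClusterPt {X : Type*} [MetricSpace X] {u : ℕ → X}
    (h : ∀ x, ¬ MapClusterPt x atTop u) : IsClosed (Set.range u) := by
  rw [← Set.iUnion_singleton_eq_range]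
  exact (locallyFinite_singleton_of_not_mapClusterPt h).isClosed_iUnion fun _ => isClosed_singleton

theorem eventually_ne_of_not_mapClusterPt {X : Type*} [MetricSpace X] {u : ℕ → X} {x : X}
    (h : ¬ MapClusterPt x atTop u) : ∀ᶠ n in atTop, u n ≠ x := by
  by_contra hne
  refine h (mapClusterPt_iff_forall_dist_lt.2 fun ε hε => ?_)
  refine (not_eventually.1 hne).mono fun n hn => ?_
  rw [not_not.1 hn, dist_self]
  exact hε

/-- Two sequences without cluster points that differ at every index have subsequences with
disjoint ranges. -/
theorem exists_strictMono_disjoint_range {X : Type*} [MetricSpace X] {u v : ℕ → X}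
    (hu : ∀ x, ¬ MapClusterPt x atTop u) (hv : ∀ x, ¬ MapClusterPt x atTop v)
    (huv : ∀ n, u n ≠ v n) :
    ∃ φ : ℕ → ℕ, StrictMono φ ∧ Disjoint (Set.range (u ∘ φ)) (Set.range (v ∘ φ)) := by
  obtain ⟨φ, -, hφ⟩ := exists_seq_of_forall_finset_exists (fun _ : ℕ => True)
    (fun m n => m < n ∧ u n ≠ v m ∧ v n ≠ u m) (fun s _ => by
      have : ∀ᶠ n in atTop, ∀ m ∈ s, m < n ∧ u n ≠ v m ∧ v n ≠ u m :=
        (eventually_all_finset s).2 fun m _ => (eventually_gt_atTop m).and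
          ((eventually_ne_of_not_mapClusterPt (hu _)).and
            (eventually_ne_of_not_mapClusterPt (hv _)))
      obtain ⟨n, hn⟩ := this.exists
      exact ⟨n, trivial, hn⟩)
  refine ⟨φ, fun m n h => (hφ m n h).1, Set.disjoint_left.2 ?_⟩
  rintro _ ⟨m, rfl⟩ ⟨n, hn⟩
  rcases lt_trichotomy m n with h | rfl | h
  · exact (hφ m n h).2.2 hn
  · exact huv _ hn.symm
  · exact (hφ n m h).2.1 hn.symm

/-- In a UC-subset, a sequence approached by distinct points of the space has a cluster point. -/
theorem IsUCSubset.exists_mapClusterPt {X : Type*} [MetricSpace X] {A : Set X}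
    (hA : IsUCSubset A) {u v : ℕ → X} (hu : ∀ n, u n ∈ A) (huv : ∀ n, v n ≠ u n)
    (h : Tendsto (fun n => dist (u n) (v n)) atTop (𝓝 0)) : ∃ x, MapClusterPt x atTop u :=
  hA u hu (squeeze_zero (fun _ => infDist_nonneg) (fun n => infDist_le_dist_of_mem (huv n)) h)

theorem gap_le_dist {X : Type*} [MetricSpace X] {C E : Set X} {c e : X} (hc : c ∈ C)
    (he : e ∈ E) : gap C E ≤ dist c e :=
  csInf_le ⟨0, by rintro _ ⟨c, -, e, -, rfl⟩; exact dist_nonneg⟩ ⟨c, hc, e, he, rfl⟩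

theorem exists_dist_lt_of_gap_nonpos {X : Type*} [MetricSpace X] {C E : Set X}
    (hC : C.Nonempty) (hE : E.Nonempty) (h : gap C E ≤ 0) {ε : ℝ} (hε : 0 < ε) :
    ∃ c ∈ C, ∃ e ∈ E, dist c e < ε := by
  obtain ⟨c, hc⟩ := hC
  obtain ⟨e, he⟩ := hE
  obtain ⟨_, ⟨c', hc', e', he', rfl⟩, hlt⟩ :=
    exists_lt_of_csInf_lt (s := {r : ℝ | ∃ c ∈ C, ∃ e ∈ E, r = dist c e})
      ⟨_, c, hc, e, he, rfl⟩ (h.trans_lt hε)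
  exact ⟨c', hc', e', he', hlt⟩

theorem IsUCSubset.omega_lt_top {X : Type*} [MetricSpace X] {A : Set X} (hA : IsUCSubset A)
    {f : X → ℝ} (hf : Continuous f) : Omega f A < ⊤ := by
  by_contra htop
  have key : ∀ n : ℕ, ∃ a ∈ A, ∃ b, b ≠ a ∧ dist a b ≤ 2 * (1 / ((n : ℝ) + 1)) ∧
      ∃ x w, dist x a ≤ 2 * (1 / ((n : ℝ) + 1)) ∧ dist w a ≤ 2 * (1 / ((n : ℝ) + 1)) ∧
        2 < dist (f x) (f w) := by
    intro n
    have hn : OmegaN f A (n + 1) = ⊤ :=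
      top_le_iff.1 ((not_lt_top_iff.1 htop).ge.trans (iInf_le _ n))
    have hlt : ENNReal.ofReal 2 < OmegaN f A (n + 1) := hn ▸ ENNReal.ofReal_lt_top
    simp only [OmegaN, lt_iSup_iff, Nat.cast_add, Nat.cast_one] at hlt
    obtain ⟨x, hx, w, -, hxw, hfxw⟩ := hlt
    obtain ⟨a, ha, hxa⟩ := mem_SEnl_iff.1 hx
    have hwa : dist w a ≤ 2 * (1 / ((n : ℝ) + 1)) := by
      linarith [dist_triangle_left w a x]
    have hxa' : dist x a ≤ 2 * (1 / ((n : ℝ) + 1)) := by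
      linarith [dist_nonneg (x := x) (y := a)]
    have hd : 2 < dist (f x) (f w) := by
      rw [edist_dist] at hfxw
      exact (ENNReal.ofReal_lt_ofReal_iff_of_nonneg zero_le_two).1 hfxw
    by_cases hxe : x = a
    · have hw : w ≠ a := by
        rintro rfl
        rw [hxe, dist_self] at hd
        linarith
      exact ⟨a, ha, w, hw, by rwa [dist_comm], x, w, hxa', hwa, hd⟩
    · exact ⟨a, ha, x, hxe, by rwa [dist_comm], x, w, hxa', hwa, hd⟩
  choose a ha b hba hab x w hx hw hd using key
  have hlim : Tendsto (fun n : ℕ => 2 * (1 / ((n : ℝ) + 1))) atTop (𝓝 0) := by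
    simpa using (tendsto_one_div_add_atTop_nhds_zero_nat (𝕜 := ℝ)).const_mul 2
  obtain ⟨p, hp⟩ := hA.exists_mapClusterPt ha hba (squeeze_zero (fun _ => dist_nonneg) hab hlim)
  obtain ⟨δ, hδ, hfδ⟩ := Metric.continuous_iff.1 hf p 1 one_pos
  obtain ⟨n, hn, hn'⟩ := ((mapClusterPt_iff_forall_dist_lt.1 hp (δ / 2) (half_pos hδ)).and_eventually
    (hlim.eventually_lt_const (half_pos hδ))).exists
  have h1 := hfδ (x n) (by linarith [dist_triangle (x n) (a n) p, hx n])
  have h2 := hfδ (w n) (by linarith [dist_triangle (w n) (a n) p, hw n])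
  linarith [dist_triangle_right (f (x n)) (f (w n)) (f p), hd n]

/-- Disjoint closed sets `C ⊆ A` and `E` with zero gap are witnessed by a continuous function of
infinite oscillation at `A`. -/
theorem exists_continuous_omega_eq_top {X : Type*} [MetricSpace X] {A C E : Set X}
    (hC : C.Nonempty) (hE : E.Nonempty) (hCc : IsClosed C) (hEc : IsClosed E) (hCA : C ⊆ A)
    (hCE : Disjoint C E) (hgap : gap C E ≤ 0) :
    ∃ f : X → ℝ, Continuous f ∧ Omega f A = ⊤ := by
  have hpos : ∀ x, 0 < infDist x C + infDist x E := by
    intro x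
    rcases (infDist_nonneg (x := x) (s := C)).eq_or_lt with h | h
    · have hxC : x ∈ C := (hCc.mem_iff_infDist_zero hC).2 h.symm
      have := (hEc.notMem_iff_infDist_pos hE).1 (Set.disjoint_left.1 hCE hxC)
      linarith
    · linarith [infDist_nonneg (x := x) (s := E)]
  refine ⟨fun x => infDist x C / (infDist x C + infDist x E) ^ 2, ?_, ?_⟩
  · exact (continuous_infDist_pt C).div₀
      (((continuous_infDist_pt C).add (continuous_infDist_pt E)).pow 2)
      fun x => (pow_pos (hpos x) 2).ne'
  · refine iInf_eq_top.2 fun n => ENNReal.eq_top_of_forall_nnreal_le fun r => ?_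
    have hr : (0 : ℝ) < r + 1 := by positivity
    have hn : (0 : ℝ) < 1 / ((n + 1 : ℕ) : ℝ) := by positivity
    obtain ⟨c, hc, e, he, hce⟩ := exists_dist_lt_of_gap_nonpos hC hE hgap
      (lt_min hn (one_div_pos.2 hr))
    have hc' : c ∈ SEnl A (1 / ((n + 1 : ℕ) : ℝ)) :=
      mem_SEnl_iff.2 ⟨c, hCA hc, by rwa [dist_self]⟩
    have he' : e ∈ SEnl A (1 / ((n + 1 : ℕ) : ℝ)) :=
      mem_SEnl_iff.2 ⟨c, hCA hc, by rw [dist_comm]; exact hce.trans_le (min_le_left _ _)⟩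
    unfold OmegaN
    refine le_iSup₂_of_le c hc' (le_iSup₂_of_le e he'
      (le_iSup_of_le (hce.trans_le (min_le_left _ _)) ?_))
    have hce' : 0 < infDist e C := by simpa [infDist_zero_of_mem he] using hpos e
    have hle : infDist e C ≤ 1 / ((r : ℝ) + 1) :=
      (infDist_le_dist_of_mem hc).trans
        (by rw [dist_comm]; exact (hce.trans_le (min_le_right _ _)).le)
    have hval : infDist e C / (infDist e C + infDist e E) ^ 2 = 1 / infDist e C := by
      rw [infDist_zero_of_mem he]
      field_simp
      ring
    beta_reduce
    rw [hval, infDist_zero_of_mem hc, zero_div, edist_dist, Real.dist_eq, zero_sub, abs_neg,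
      abs_of_pos (one_div_pos.2 hce'), ← ENNReal.ofReal_coe_nnreal]
    refine ENNReal.ofReal_le_ofReal ?_
    have := (le_one_div hce' hr).1 hle
    linarith

theorem isUCSubset_of_gap_pos {X : Type*} [MetricSpace X] {A : Set X}
    (h : ∀ C E : Set X, C.Nonempty → E.Nonempty → IsClosed C → IsClosed E →
      C ⊆ A → C ∩ E = ∅ → 0 < gap C E) : IsUCSubset A := by
  intro a ha hlim
  by_contra! hcl
  have hne : ∀ n, ({a n}ᶜ : Set X).Nonempty := by
    intro n
    by_contra hemp
    have hall : ∀ x, x = a n := by simpa [Set.nonempty_def] using hemp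
    obtain ⟨m, hm⟩ := (eventually_ne_of_not_mapClusterPt (hcl (a n))).exists
    exact hm (hall _)
  have hex : ∀ n, ∃ b, b ≠ a n ∧ dist (a n) b < infDist (a n) {a n}ᶜ + 1 / ((n : ℝ) + 1) :=
    fun n => (infDist_lt_iff (hne n)).1 (lt_add_of_pos_right _ Nat.one_div_pos_of_nat)
  choose b hba hab using hex
  have hd : Tendsto (fun n => dist (a n) (b n)) atTop (𝓝 0) :=
    squeeze_zero (fun _ => dist_nonneg) (fun n => (hab n).le)
      (by simpa using hlim.add (tendsto_one_div_add_atTop_nhds_zero_nat (𝕜 := ℝ)))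
  have hcl' : ∀ x, ¬ MapClusterPt x atTop b := fun x hx => hcl x (hx.of_tendsto_dist hd)
  obtain ⟨φ, hφ, hdisj⟩ := exists_strictMono_disjoint_range hcl hcl' fun n => (hba n).symm
  have hpos := h (Set.range (a ∘ φ)) (Set.range (b ∘ φ)) (Set.range_nonempty _)
    (Set.range_nonempty _)
    (isClosed_range_of_not_mapClusterPt fun x hx => hcl x (hx.of_comp hφ.tendsto_atTop))
    (isClosed_range_of_not_mapClusterPt fun x hx => hcl' x (hx.of_comp hφ.tendsto_atTop))
    (Set.range_subset_iff.2 fun n => ha _) hdisj.inter_eq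
  obtain ⟨n, hn⟩ := ((hd.comp hφ.tendsto_atTop).eventually_lt_const hpos).exists
  exact hn.not_ge (gap_le_dist (Set.mem_range_self n) (Set.mem_range_self n))

theorem IsUCSubset.gap_pos {X : Type*} [MetricSpace X] {A C E : Set X} (hA : IsUCSubset A)
    (hC : C.Nonempty) (hE : E.Nonempty) (hCc : IsClosed C) (hEc : IsClosed E) (hCA : C ⊆ A)
    (hCE : Disjoint C E) : 0 < gap C E := by
  by_contra hgap
  obtain ⟨f, hf, htop⟩ :=
    exists_continuous_omega_eq_top hC hE hCc hEc hCA hCE (not_lt.1 hgap)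
  exact (hA.omega_lt_top hf).ne htop

/-- Characterization of UC-subsets: `A` is a UC-subset iff every continuous real-valued
function on `X` has finite oscillation at `A`, iff every pair of disjoint nonempty closed
sets `C ⊆ A` and `E` has positive gap. -/
theorem isUCSubset_iff_oscillation_finite_iff_gap_pos
    {X : Type*} [MetricSpace X] (A : Set X) (hA : A.Nonempty) :
    (IsUCSubset A ↔ ∀ f : X → ℝ, Continuous f → Omega f A < ⊤) ∧
    (IsUCSubset A ↔ ∀ C E : Set X, C.Nonempty → E.Nonempty → IsClosed C → IsClosed E →
      C ⊆ A → C ∩ E = ∅ → 0 < gap C E) := by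
  have of_oscillation : (∀ f : X → ℝ, Continuous f → Omega f A < ⊤) → IsUCSubset A := by
    refine fun h => isUCSubset_of_gap_pos fun C E hC hE hCc hEc hCA hCE => ?_
    by_contra hgap
    obtain ⟨f, hf, htop⟩ := exists_continuous_omega_eq_top hC hE hCc hEc hCA
      (Set.disjoint_iff_inter_eq_empty.2 hCE) (not_lt.1 hgap)
    exact (h f hf).ne htop
  exact ⟨⟨fun h _ hf => h.omega_lt_top hf, of_oscillation⟩,
    fun h _ _ hC hE hCc hEc hCA hCE =>
      h.gap_pos hC hE hCc hEc hCA (Set.disjoint_iff_inter_eq_empty.2 hCE),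
    isUCSubset_of_gap_pos⟩
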